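/- Let Λ and Λ′ be topological Markov chains over alphabets A and A′, let Σ_n be the full shift on {1,…,n}, and let Θ : Λ → Λ′ be a bijective 1-block code with local rule θ that is constant on each predecessor set of Λ and whose inverse Θ^{−1} is a block code with memory 1 and anticipation 0. Let φ := Θ × id : Λ × Σ_n → Λ′ × Σ_n be the 1-block code induced by the letter map (a,c) ↦ (θ(a),c), where Λ × Σ_n and Λ′ × Σ_n are regarded as topological Markov chains over the alphabets A × {1,…,n} and A′ × {1,…,n}. If μ is a shift-invariant probability measure on Λ × Σ_n with complete connections (compatible with Λ × Σ_n) and summable decay, then μ ∘ φ^{−1} is a shift-invariant probability measure on Λ′ × Σ_n with complete connections (compatible with Λ′ × Σ_n) and summable decay. -/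

import Mathlib

open Filter Topology MeasureTheory
open scoped ENNReal

namespace CAStmt

/-- The shift map on bi-infinite sequences. -/
def shiftMap {G : Type*} (x : ℤ → G) : ℤ → G := fun n => x (n + 1)

/-- The topological Markov chain determined by the transition set `E`. -/
def TMC {G : Type*} (E : Set (G × G)) : Set (ℤ → G) := {x | ∀ i : ℤ, (x i, x (i + 1)) ∈ E}

/-- The word `w` occurs in some point of `X`. -/
def WordIn {G : Type*} (X : Set (ℤ → G)) {m : ℕ} (w : Fin m → G) : Prop :=
  ∃ x ∈ X, ∃ j : ℤ, ∀ i : Fin m, x (j + ((i : ℕ) : ℤ)) = w i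

/-- Every letter of the alphabet occurs in some point of the TMC. -/
def EveryLetterOccurs {G : Type*} (E : Set (G × G)) : Prop :=
  ∀ g : G, ∃ x ∈ TMC E, ∃ i : ℤ, x i = g

/-- The radius-1 cellular automaton map with local rule `φ`. -/
def CA {G : Type*} (φ : G → G → G) (x : ℤ → G) : ℤ → G := fun j => φ (x j) (x (j + 1))

/-- Structural compatibility of the local rule `φ` with the TMC of `E`. -/
def SC {G : Type*} (E : Set (G × G)) (φ : G → G → G) : Prop :=
  ∀ x ∈ TMC E, ∀ y ∈ TMC E, (fun i => φ (x i) (y i)) ∈ TMC E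

def RightPerm {G : Type*} (φ : G → G → G) : Prop := ∀ a, Function.Bijective (φ a)

def LeftPerm {G : Type*} (φ : G → G → G) : Prop := ∀ b, Function.Bijective (fun a => φ a b)

/-- Irreducibility: any two letters are joined by an allowed word `(u,v₁,…,v_k,w)`, `k ≥ 1`. -/
def IrreducibleTMC {G : Type*} (E : Set (G × G)) : Prop :=
  ∀ u w : G, ∃ x ∈ TMC E, ∃ i j : ℤ, i + 1 < j ∧ x i = u ∧ x j = w

/-- Mixing with mixing constant `q`. -/
def MixingTMCWith {G : Type*} (E : Set (G × G)) (q : ℕ) : Prop :=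
  1 ≤ q ∧ ∀ k : ℕ, q ≤ k → ∀ u w : G,
    ∃ x ∈ TMC E, ∃ i : ℤ, x i = u ∧ x (i + (k : ℤ) + 1) = w

def MixingTMC {G : Type*} (E : Set (G × G)) : Prop := ∃ q, MixingTMCWith E q

/-- `Φ` is `N`-scaling on `X`: `(Φ^N x)₀ = φ(x₀, x_N)`. -/
def NScalingOn {G : Type*} (X : Set (ℤ → G)) (φ : G → G → G) (N : ℕ) : Prop :=
  ∀ x ∈ X, (CA φ)^[N] x 0 = φ (x 0) (x (N : ℤ))

/-- The TMC `𝔥(𝔽,τ,n)` over the alphabet `F × Fin n`. -/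
def hTMC {F : Type*} (τ : Equiv.Perm F) (n : ℕ) : Set (ℤ → F × Fin n) :=
  TMC {p : (F × Fin n) × (F × Fin n) | p.2.1 = τ p.1.1}

/-- `op` is a `k`-block operation (memory 0, anticipation `k-1`) closed on `Λ`. -/
def KBlockOp {A : Type*} (Λ : Set (ℤ → A)) (k : ℕ)
    (op : (ℤ → A) → (ℤ → A) → (ℤ → A)) : Prop :=
  (∀ x ∈ Λ, ∀ y ∈ Λ, op x y ∈ Λ) ∧
  ∃ ρ : (Fin k → A) → (Fin k → A) → A,
    ∀ x ∈ Λ, ∀ y ∈ Λ, ∀ j : ℤ,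
      op x y j = ρ (fun i => x (j + ((i : ℕ) : ℤ))) (fun i => y (j + ((i : ℕ) : ℤ)))

/-- `op` is a quasigroup operation on `Λ`: all translations are bijections of `Λ`. -/
def QuasigroupOp {A : Type*} (Λ : Set (ℤ → A)) (op : (ℤ → A) → (ℤ → A) → (ℤ → A)) : Prop :=
  ∀ z ∈ Λ, Set.BijOn (fun x => op x z) Λ Λ ∧ Set.BijOn (fun y => op z y) Λ Λ

/-- A 1-block topological conjugacy between `(X,Φ)` and `(Y,Ψ)` induced by the letter map `θ`. -/
def OneBlockConjugacy {A B : Type*} (X : Set (ℤ → A)) (Φ : (ℤ → A) → (ℤ → A))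
    (Y : Set (ℤ → B)) (Ψ : (ℤ → B) → (ℤ → B)) (θ : A → B) : Prop :=
  Set.BijOn (fun x => θ ∘ x) X Y ∧ ∀ x ∈ X, θ ∘ (Φ x) = Ψ (θ ∘ x)

/-- `add` is an abelian group operation. -/
def IsAbelianGroupOp {K : Type*} (add : K → K → K) : Prop :=
  (∀ a b c, add (add a b) c = add a (add b c)) ∧ (∀ a b, add a b = add b a) ∧
  ∃ z : K, (∀ a, add z a = a) ∧ ∀ a, ∃ b, add a b = z

/-- The product transition set on `K × B`. -/
def prodE {K B : Type*} (EK : Set (K × K)) (EB : Set (B × B)) : Set ((K × B) × (K × B)) :=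
  {p | (p.1.1, p.2.1) ∈ EK ∧ (p.1.2, p.2.2) ∈ EB}

/-- `φK` is an affine local rule for the abelian group operation `add`. -/
def IsAffineRuleExpl {K : Type*} (add : K → K → K) (φK : K → K → K) : Prop :=
  IsAbelianGroupOp add ∧
  ∃ (η ρc : K → K) (c : K), Function.Bijective η ∧ Function.Bijective ρc ∧
    (∀ a b, η (add a b) = add (η a) (η b)) ∧ (∀ a b, ρc (add a b) = add (ρc a) (ρc b)) ∧
    (∀ a, η (ρc a) = ρc (η a)) ∧
    ∀ a b, φK a b = add (add (η a) (ρc b)) c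

/-- The cylinder on the word `w` at coordinates `0,…,m-1`. -/
def cyl {A : Type*} {m : ℕ} (w : Fin m → A) : Set (ℤ → A) :=
  {x | ∀ i : Fin m, x ((i : ℕ) : ℤ) = w i}

/-- A past: `p i` is the letter at coordinate `-(i+1)`; all transitions allowed. -/
def IsPast {A : Type*} (E : Set (A × A)) (p : ℕ → A) : Prop :=
  ∀ i : ℕ, (p (i + 1), p i) ∈ E

/-- The word `(w_{-m},…,w_{-1})` of the past `p`. -/
def pastWord {A : Type*} (p : ℕ → A) (m : ℕ) : Fin m → A :=
  fun j => p (m - 1 - (j : ℕ))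

/-- `μ` has complete connections (compatible with the TMC of `E`) and summable decay. -/
def CCSD {A : Type*} [MeasurableSpace A] (E : Set (A × A)) (μ : Measure (ℤ → A)) : Prop :=
  ∃ ν : (ℕ → A) → A → ℝ,
    (∀ p, IsPast E p → ∀ a, (p 0, a) ∈ E →
      0 < ν p a ∧
      Tendsto (fun m : ℕ =>
          (μ (cyl (Fin.snoc (pastWord p m) a))).toReal / (μ (cyl (pastWord p m))).toReal)
        atTop (nhds (ν p a))) ∧
    ∃ γ : ℕ → ℝ, Summable γ ∧
      ∀ m : ℕ, 1 ≤ m → ∀ p q, IsPast E p → IsPast E q → (∀ i < m, p i = q i) →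
        ∀ a, (p 0, a) ∈ E → |ν p a / ν q a - 1| ≤ γ m

/-- A shift-invariant probability measure carried by the TMC of `E`, positive on allowed
cylinders. -/
def GoodMeasure {A : Type*} [MeasurableSpace A] (E : Set (A × A)) (μ : Measure (ℤ → A)) : Prop :=
  IsProbabilityMeasure μ ∧ Measure.map shiftMap μ = μ ∧ μ (TMC E) = 1 ∧
  ∀ (m : ℕ) (w : Fin m → A), WordIn (TMC E) w → 0 < μ (cyl w)

/-- The identification of `𝔽 × Σ_n` with `𝔥(𝔽,τ,n)`. -/
def ident {F : Type*} (τ : Equiv.Perm F) {n : ℕ} (f : F) (y : ℤ → Fin n) : ℤ → F × Fin n :=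
  fun i => ((τ ^ i) f, y i)

/-- A quasigroup operation on an alphabet. -/
def QuasigroupPointOp {K : Type*} (o : K → K → K) : Prop :=
  ∀ a, Function.Bijective (fun x => o x a) ∧ Function.Bijective (o a)

/-- The data witnessing that an SC bipermutative c.a. is regular and simple. -/
def RegularSimpleData {K F : Type*} (EK : Set (K × K)) (φK : K → K → K)
    (τ : Equiv.Perm F) (n k : ℕ)
    (op : (ℤ → F × Fin n) → (ℤ → F × Fin n) → (ℤ → F × Fin n))
    (θ : K → F × Fin n) (oF : F → F → F) (oS : Fin n → Fin n → Fin n) : Prop :=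
  1 ≤ n ∧ 1 ≤ k ∧
  KBlockOp (hTMC τ n) k op ∧ QuasigroupOp (hTMC τ n) op ∧
  OneBlockConjugacy (TMC EK) (CA φK) (hTMC τ n) (fun x => op x (shiftMap x)) θ ∧
  QuasigroupPointOp oF ∧ QuasigroupPointOp oS ∧
  ∀ (f g : F) (y z : ℤ → Fin n),
    op (ident τ f y) (ident τ g z) = ident τ (oF f g) (fun i => oS (y i) (z i))

/-- An SC bipermutative c.a. is regular and simple. -/
def RegularSimple {K : Type*} (EK : Set (K × K)) (φK : K → K → K) : Prop :=
  ∃ (F : Type) (_ : Fintype F) (τ : Equiv.Perm F) (n k : ℕ)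
    (op : (ℤ → F × Fin n) → (ℤ → F × Fin n) → (ℤ → F × Fin n))
    (θ : K → F × Fin n) (oF : F → F → F) (oS : Fin n → Fin n → Fin n),
    RegularSimpleData EK φK τ n k op θ oF oS

/-- Weak-* convergence of the Cesàro means of `μ` under `Φ` to `κ`. -/
def CesaroTendstoTo {G : Type*} [TopologicalSpace G] [MeasurableSpace G]
    (μ : Measure (ℤ → G)) (Φ : (ℤ → G) → (ℤ → G)) (κ : Measure (ℤ → G)) : Prop :=
  ∀ f : C(ℤ → G, ℝ), Tendsto
    (fun N : ℕ => (N : ℝ)⁻¹ * ∑ n ∈ Finset.range N, ∫ x, f (Φ^[n] x) ∂μ)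
    atTop (nhds (∫ x, f x ∂κ))

/-- `κ` is the Parry measure of the irreducible TMC of `E`. -/
def IsParryMeasure {G : Type*} [Fintype G] [MeasurableSpace G] (E : Set (G × G))
    (κ : Measure (ℤ → G)) : Prop :=
  IsProbabilityMeasure κ ∧ Measure.map shiftMap κ = κ ∧
  ∃ (lam : ℝ) (r l : G → ℝ), 0 < lam ∧ (∀ a, 0 < r a) ∧ (∀ a, 0 < l a) ∧
    (∀ a : G, (∑ b : G, E.indicator (fun _ => r b) (a, b)) = lam * r a) ∧
    (∀ b : G, (∑ a : G, E.indicator (fun _ => l a) (a, b)) = lam * l b) ∧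
    (∑ a : G, l a * r a) = 1 ∧
    ∀ (m : ℕ) (w : Fin (m + 1) → G), WordIn (TMC E) w →
      (κ (cyl w)).toReal = l (w 0) * r (w (Fin.last m)) / lam ^ m

/-- Entropy of the refinement `P ∨ T⁻¹P ∨ ⋯ ∨ T^{-(n-1)}P`. -/
noncomputable def joinEntropy {X : Type*} [MeasurableSpace X] (μ : Measure X) (T : X → X)
    {r : ℕ} (P : Fin r → Set X) (n : ℕ) : ℝ :=
  -∑ c : Fin n → Fin r,
      ((μ (⋂ i : Fin n, T^[(i : ℕ)] ⁻¹' P (c i))).toReal *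
        Real.log (μ (⋂ i : Fin n, T^[(i : ℕ)] ⁻¹' P (c i))).toReal)

/-- The Kolmogorov–Sinai entropy `h_μ(T)` is positive: some finite measurable partition has
positive entropy. -/
def KSEntropyPos {X : Type*} [MeasurableSpace X] (μ : Measure X) (T : X → X) : Prop :=
  ∃ (r : ℕ) (P : Fin r → Set X), (∀ i, MeasurableSet (P i)) ∧
    Pairwise (Function.onFun Disjoint P) ∧ (⋃ i, P i) = Set.univ ∧
    0 < Filter.liminf (fun n : ℕ => joinEntropy μ T P n / n) Filter.atTop

end CAStmt

namespace CAStmt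

/-- The cylinder of points whose letter at coordinate `-(i+1)` is `f i`, for `i < m`. -/
def pastCyl {B : Type*} (f : ℕ → B) (m : ℕ) : Set (ℤ → B) :=
  {x | ∀ i < m, x (-(i : ℤ) - 1) = f i}

theorem pastCyl_congr {B : Type*} {f g : ℕ → B} {m : ℕ} (h : ∀ i < m, f i = g i) :
    pastCyl f m = pastCyl g m := by
  ext x
  exact forall₂_congr fun i hi => by rw [h i hi]

theorem pastCyl_update_succ {B : Type*} (f : ℕ → B) (m : ℕ) (u : B) :
    pastCyl (Function.update f m u) (m + 1) = pastCyl f m ∩ {x | x (-(m : ℤ) - 1) = u} := by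
  ext x
  simp only [pastCyl, Set.mem_ofPred_eq, Set.mem_inter_iff]
  constructor
  · intro h
    refine ⟨fun i hi => ?_, ?_⟩
    · rw [h i (by omega), Function.update_of_ne (by omega)]
    · rw [h m (by omega), Function.update_self]
  · rintro ⟨h, h'⟩ i hi
    rcases Nat.lt_succ_iff_lt_or_eq.mp hi with hi | rfl
    · rw [h i hi, Function.update_of_ne (by omega)]
    · rw [h', Function.update_self]

theorem shiftMap_iterate {B : Type*} (m : ℕ) (x : ℤ → B) (k : ℤ) :
    (shiftMap^[m] x) k = x (k + m) := by
  induction m generalizing x with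
  | zero => simp
  | succ m ih =>
    rw [Function.iterate_succ_apply, ih, shiftMap]
    congr 1
    push_cast
    ring

theorem mem_cyl_pastWord_iff {B : Type*} (f : ℕ → B) (m : ℕ) (x : ℤ → B) :
    x ∈ cyl (pastWord f m) ↔ shiftMap^[m] x ∈ pastCyl f m := by
  simp only [cyl, pastWord, pastCyl, Set.mem_ofPred_eq, shiftMap_iterate]
  constructor
  · intro h i hi
    have := h ⟨m - 1 - i, by omega⟩
    simp only at this
    rw [show m - 1 - (m - 1 - i) = i by omega] at this
    rw [← this]
    congr 1
    omega
  · intro h i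
    rw [← h (m - 1 - i) (by omega)]
    congr 1
    omega

theorem mem_cyl_snoc_pastWord_iff {B : Type*} (f : ℕ → B) (m : ℕ) (a : B) (x : ℤ → B) :
    x ∈ cyl (Fin.snoc (pastWord f m) a : Fin (m + 1) → B) ↔
      shiftMap^[m] x ∈ pastCyl f m ∩ {x | x 0 = a} := by
  rw [Set.mem_inter_iff, ← mem_cyl_pastWord_iff]
  simp only [cyl, Set.mem_ofPred_eq, Fin.forall_fin_succ', shiftMap_iterate, Fin.snoc_castSucc,
    Fin.snoc_last, Fin.val_castSucc, Fin.val_last, zero_add]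

theorem exists_seq_of_step {B : Type*} {P : ℕ → (ℕ → B) → Prop}
    (hcongr : ∀ m f g, (∀ i < m, f i = g i) → P m f → P m g)
    (hstep : ∀ m f, P m f → ∃ u, P (m + 1) (Function.update f m u))
    {k : ℕ} {f : ℕ → B} (h : P k f) :
    ∃ q : ℕ → B, (∀ i < k, q i = f i) ∧ ∀ m, k ≤ m → P m q := by
  have : Nonempty B := ⟨f 0⟩
  choose! u hu using hstep
  let F : ℕ → ℕ → B := fun j => Nat.rec f (fun j g => Function.update g (k + j) (u (k + j) g)) j
  have hF : ∀ j, F (j + 1) = Function.update (F j) (k + j) (u (k + j) (F j)) := fun j => rfl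
  have hP : ∀ j, P (k + j) (F j) := by
    intro j
    induction j with
    | zero => exact h
    | succ j ih => exact hu _ _ ih
  have hco : ∀ j l i, i < k + j → F (j + l) i = F j i := by
    intro j l i hi
    induction l with
    | zero => rfl
    | succ l ih =>
      rw [← add_assoc, hF, Function.update_of_ne (by omega), ih]
  refine ⟨fun i => F (i + 1) i, fun i hi => ?_, fun m hm => ?_⟩
  · have := hco 0 (i + 1) i (by omega)
    rwa [zero_add] at this
  · obtain ⟨j, rfl⟩ := Nat.exists_eq_add_of_le hm
    refine hcongr _ _ _ (fun i hi => ?_) (hP j)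
    rw [← hco (i + 1) j i (by omega), ← hco j (i + 1) i hi, add_comm]

theorem measurable_shiftMap {B : Type*} [MeasurableSpace B] :
    Measurable (shiftMap : (ℤ → B) → ℤ → B) :=
  measurable_pi_lambda _ fun i => measurable_pi_apply (i + 1)

section Measure

variable {B : Type*} [MeasurableSpace B]

theorem GoodMeasure.measurePreserving {E : Set (B × B)} {μ : Measure (ℤ → B)}
    (h : GoodMeasure E μ) (m : ℕ) : MeasurePreserving (shiftMap^[m]) μ μ :=
  MeasurePreserving.iterate ⟨measurable_shiftMap, h.2.1⟩ m

/-- `ν p a` is the limiting conditional probability of `a` given the past `p`. -/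
def IsTransition (E : Set (B × B)) (μ : Measure (ℤ → B)) (ν : (ℕ → B) → B → ℝ) : Prop :=
  ∀ p, IsPast E p → ∀ a, (p 0, a) ∈ E →
    0 < ν p a ∧
    Tendsto (fun m : ℕ => μ.real (pastCyl p m ∩ {x | x 0 = a}) / μ.real (pastCyl p m))
      atTop (𝓝 (ν p a))

theorem IsTransition.le_one {E : Set (B × B)} {μ : Measure (ℤ → B)} (hμ : GoodMeasure E μ)
    {ν : (ℕ → B) → B → ℝ} (hν : IsTransition E μ ν) {p : ℕ → B} (hp : IsPast E p) {a : B}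
    (ha : (p 0, a) ∈ E) : ν p a ≤ 1 := by
  have := hμ.1
  refine le_of_tendsto (hν p hp a ha).2 (Eventually.of_forall fun m => ?_)
  exact div_le_one_of_le₀ (measureReal_mono Set.inter_subset_left) measureReal_nonneg

variable [Finite B]

theorem IsTransition.exists_div_le {E : Set (B × B)} {μ : Measure (ℤ → B)} (hμ : GoodMeasure E μ)
    {ν : (ℕ → B) → B → ℝ} (hν : IsTransition E μ ν) {c : ℝ}
    (hc : ∀ p q, IsPast E p → IsPast E q → p 0 = q 0 →
        ∀ a, (p 0, a) ∈ E → |ν p a / ν q a - 1| ≤ c) :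
    ∃ K : ℝ, ∀ p q, IsPast E p → IsPast E q → ∀ a b, (p 0, a) ∈ E → (q 0, b) ∈ E →
      ν p a / ν q b ≤ K := by
  have hK : ∀ e : B × B, ∃ K : ℝ, 0 ≤ K ∧ ∀ q, IsPast E q → q 0 = e.1 → e ∈ E →
      1 / ν q e.2 ≤ K := by
    rintro ⟨g, b⟩
    by_cases hex : ∃ q, IsPast E q ∧ q 0 = g ∧ (g, b) ∈ E
    · obtain ⟨q₀, hq₀, rfl, hb⟩ := hex
      have h0 := (hν q₀ hq₀ b hb).1
      have hc0 : 0 ≤ c := (abs_nonneg _).trans (hc q₀ q₀ hq₀ hq₀ rfl b hb)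
      refine ⟨(c + 1) / ν q₀ b, by positivity, fun q hq hqq _ => ?_⟩
      have h1 := (abs_le.1 (hc q₀ q hq₀ hq hqq.symm b hb)).2
      rw [le_div_iff₀ h0, one_div_mul_eq_div]
      linarith
    · refine ⟨0, le_rfl, fun q hq hqg hE => absurd ⟨q, hq, hqg, hE⟩ hex⟩
  choose K hK0 hK using hK
  have := Fintype.ofFinite B
  refine ⟨∑ e, K e, fun p q hp hq a b ha hb => ?_⟩
  have h0 := (hν q hq b hb).1
  calc ν p a / ν q b ≤ 1 / ν q b := by gcongr; exact hν.le_one hμ hp ha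
    _ ≤ K (q 0, b) := hK (q 0, b) q hq rfl hb
    _ ≤ ∑ e, K e := Finset.single_le_sum (fun e _ => hK0 e) (Finset.mem_univ _)

variable [MeasurableSingletonClass B]

theorem measurableSet_coord (k : ℤ) (U : Set B) : MeasurableSet {x : ℤ → B | x k ∈ U} :=
  measurable_pi_apply k (Set.toFinite U).measurableSet

theorem measurableSet_coord_eq (k : ℤ) (a : B) : MeasurableSet {x : ℤ → B | x k = a} :=
  measurableSet_coord k {a}

theorem measurableSet_pastCyl (f : ℕ → B) (m : ℕ) : MeasurableSet (pastCyl f m) := by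
  have : pastCyl f m = ⋂ i : ℕ, ⋂ _ : i < m, {x : ℤ → B | x (-(i : ℤ) - 1) = f i} := by
    ext x; simp [pastCyl]
  rw [this]
  exact MeasurableSet.iInter fun i => MeasurableSet.iInter fun _ => measurableSet_coord_eq _ _

theorem measurableSet_TMC (E : Set (B × B)) : MeasurableSet (TMC E) := by
  have : TMC E = ⋂ i : ℤ, {x : ℤ → B | (x i, x (i + 1)) ∈ E} := by
    ext x; simp [TMC]
  rw [this]
  exact MeasurableSet.iInter fun i =>
    ((measurable_pi_apply i).prodMk (measurable_pi_apply (i + 1))) (Set.toFinite E).measurableSet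

theorem GoodMeasure.ae_mem {E : Set (B × B)} {μ : Measure (ℤ → B)} (h : GoodMeasure E μ) :
    ∀ᵐ x ∂μ, x ∈ TMC E := by
  have := h.1
  exact (mem_ae_iff_prob_eq_one (measurableSet_TMC E)).2 h.2.2.1

theorem GoodMeasure.measure_cyl {E : Set (B × B)} {μ : Measure (ℤ → B)}
    (h : GoodMeasure E μ) (f : ℕ → B) (m : ℕ) : μ (cyl (pastWord f m)) = μ (pastCyl f m) := by
  rw [← (h.measurePreserving m).measure_preimage (measurableSet_pastCyl f m).nullMeasurableSet]
  congr 1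
  ext x
  exact mem_cyl_pastWord_iff f m x

theorem GoodMeasure.measure_cyl_snoc {E : Set (B × B)} {μ : Measure (ℤ → B)}
    (h : GoodMeasure E μ) (f : ℕ → B) (m : ℕ) (a : B) :
    μ (cyl (Fin.snoc (pastWord f m) a : Fin (m + 1) → B)) = μ (pastCyl f m ∩ {x | x 0 = a}) := by
  rw [← (h.measurePreserving m).measure_preimage
    ((measurableSet_pastCyl f m).inter (measurableSet_coord_eq 0 a)).nullMeasurableSet]
  congr 1
  ext x
  exact mem_cyl_snoc_pastWord_iff f m a x

theorem GoodMeasure.pastCyl_pos {E : Set (B × B)} {μ : Measure (ℤ → B)}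
    (h : GoodMeasure E μ) {x : ℤ → B} (hx : x ∈ TMC E) {f : ℕ → B} {m : ℕ}
    (hf : x ∈ pastCyl f m) : 0 < μ (pastCyl f m) := by
  rw [← h.measure_cyl]
  refine h.2.2.2 _ _ ⟨x, hx, -m, fun i => ?_⟩
  rw [pastWord, ← hf (m - 1 - i) (by omega)]
  congr 1
  omega

theorem GoodMeasure.exists_mem_of_pos {E : Set (B × B)} {μ : Measure (ℤ → B)}
    (h : GoodMeasure E μ) {S : Set (ℤ → B)} (hS : 0 < μ S) : ∃ x ∈ S, x ∈ TMC E := by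
  by_contra! hn
  refine hS.ne' (measure_mono_null (fun x hx => ?_) (ae_iff.1 h.ae_mem))
  exact hn x hx

theorem GoodMeasure.isPast_of_pos {E : Set (B × B)} {μ : Measure (ℤ → B)}
    (h : GoodMeasure E μ) {q : ℕ → B} {k : ℕ} (hq : ∀ m, k ≤ m → 0 < μ (pastCyl q m)) :
    IsPast E q := by
  intro i
  obtain ⟨x, hx, hxT⟩ := h.exists_mem_of_pos (hq (k + i + 2) (by omega))
  rw [← hx i (by omega), ← hx (i + 1) (by omega)]
  convert hxT (-((i + 1 : ℕ) : ℤ) - 1) using 3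
  push_cast
  ring

theorem measureReal_eq_sum_coord [Fintype B] (μ : Measure (ℤ → B)) [IsFiniteMeasure μ]
    (S : Set (ℤ → B)) (k : ℤ) :
    μ.real S = ∑ u : B, μ.real (S ∩ {x | x k = u}) := by
  have h := sum_measureReal_preimage_singleton (μ := μ.restrict S) (Finset.univ : Finset B)
    (f := fun x : ℤ → B => x k) fun u _ => measurableSet_coord_eq k u
  rw [Finset.coe_univ, Set.preimage_univ, measureReal_restrict_apply_univ] at h
  rw [← h]
  refine Finset.sum_congr rfl fun u _ => ?_
  have hu : (fun x : ℤ → B => x k) ⁻¹' {u} = {x | x k = u} := by ext x; simp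
  rw [hu, measureReal_restrict_apply (measurableSet_coord_eq k u), Set.inter_comm]

theorem exists_extension_of_nonneg {μ : Measure (ℤ → B)} [IsFiniteMeasure μ] (s r : ℝ) (a : B)
    (U : Set B) (f : ℕ → B) (m : ℕ)
    (hpos : 0 < μ (pastCyl f m ∩ {x | x (-(m : ℤ) - 1) ∈ U}))
    (h : 0 ≤ s * (μ.real (pastCyl f m ∩ {x | x (-(m : ℤ) - 1) ∈ U} ∩ {x | x 0 = a}) -
      r * μ.real (pastCyl f m ∩ {x | x (-(m : ℤ) - 1) ∈ U}))) :
    ∃ u, 0 < μ (pastCyl (Function.update f m u) (m + 1)) ∧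
      0 ≤ s * (μ.real (pastCyl (Function.update f m u) (m + 1) ∩ {x | x 0 = a}) -
        r * μ.real (pastCyl (Function.update f m u) (m + 1))) := by
  have := Fintype.ofFinite B
  set S := pastCyl f m ∩ {x | x (-(m : ℤ) - 1) ∈ U} with hS
  by_contra! hn
  have hin : ∀ u ∈ U, S ∩ {x | x (-(m : ℤ) - 1) = u} =
      pastCyl (Function.update f m u) (m + 1) := by
    intro u hu
    rw [pastCyl_update_succ, hS]
    ext x
    simp only [Set.mem_inter_iff, Set.mem_ofPred_eq]
    constructor
    · rintro ⟨⟨h1, -⟩, h2⟩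
      exact ⟨h1, h2⟩
    · rintro ⟨h1, h2⟩
      exact ⟨⟨h1, h2 ▸ hu⟩, h2⟩
  have hout : ∀ u, u ∉ U → S ∩ {x | x (-(m : ℤ) - 1) = u} = ∅ := by
    intro u hu
    rw [Set.eq_empty_iff_forall_notMem]
    rintro x ⟨⟨-, h1⟩, h2⟩
    exact hu (h2 ▸ h1)
  let t : B → ℝ := fun u => s * (μ.real (S ∩ {x | x (-(m : ℤ) - 1) = u} ∩ {x | x 0 = a}) -
    r * μ.real (S ∩ {x | x (-(m : ℤ) - 1) = u}))
  have htz : ∀ u, μ (S ∩ {x | x (-(m : ℤ) - 1) = u}) = 0 → t u = 0 := by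
    intro u hu
    have h0 : μ.real (S ∩ {x | x (-(m : ℤ) - 1) = u}) = 0 := by simp [measureReal_def, hu]
    have h1 : μ.real (S ∩ {x | x (-(m : ℤ) - 1) = u} ∩ {x | x 0 = a}) = 0 := by
      simp [measureReal_def, measure_mono_null Set.inter_subset_left hu]
    simp [t, h0, h1]
  have htn : ∀ u, 0 < μ (S ∩ {x | x (-(m : ℤ) - 1) = u}) → t u < 0 := by
    intro u hu
    by_cases hU : u ∈ U
    · simp only [t, hin u hU]
      exact hn u (hin u hU ▸ hu)
    · rw [hout u hU, measure_empty] at hu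
      exact absurd hu (lt_irrefl _)
  have hsum : s * (μ.real (S ∩ {x | x 0 = a}) - r * μ.real S) = ∑ u, t u := by
    rw [← Finset.mul_sum, Finset.sum_sub_distrib, ← Finset.mul_sum,
      ← measureReal_eq_sum_coord μ S, measureReal_eq_sum_coord μ (S ∩ {x | x 0 = a})
        (-(m : ℤ) - 1)]
    simp only [Set.inter_right_comm]
  obtain ⟨u, hu⟩ : ∃ u, 0 < μ (S ∩ {x | x (-(m : ℤ) - 1) = u}) := by
    by_contra! hz
    have h0 : μ.real S = 0 := by
      rw [measureReal_eq_sum_coord μ S (-(m : ℤ) - 1)]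
      exact Finset.sum_eq_zero fun u _ => by simp [measureReal_def, le_antisymm (hz u) zero_le]
    rw [measureReal_eq_zero_iff] at h0
    exact hpos.ne' h0
  have : ∑ u, t u < 0 := by
    refine Finset.sum_neg' (fun u _ => ?_) ⟨u, Finset.mem_univ u, htn u hu⟩
    rcases eq_or_ne (μ (S ∩ {x | x (-(m : ℤ) - 1) = u})) 0 with h0 | h0
    · exact (htz u h0).le
    · exact (htn u (pos_iff_ne_zero.2 h0)).le
  linarith

theorem GoodMeasure.tendsto_iff {E : Set (B × B)} {μ : Measure (ℤ → B)} (h : GoodMeasure E μ)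
    (p : ℕ → B) (a : B) (c : ℝ) :
    Tendsto (fun m : ℕ =>
        (μ (cyl (Fin.snoc (pastWord p m) a))).toReal / (μ (cyl (pastWord p m))).toReal)
      atTop (𝓝 c) ↔
    Tendsto (fun m : ℕ => μ.real (pastCyl p m ∩ {x | x 0 = a}) / μ.real (pastCyl p m))
      atTop (𝓝 c) := by
  simp only [measureReal_def, ← h.measure_cyl, ← h.measure_cyl_snoc]

theorem exists_past_of_nonneg {E : Set (B × B)} {μ : Measure (ℤ → B)} (hμ : GoodMeasure E μ)
    {ν : (ℕ → B) → B → ℝ} (hν : IsTransition E μ ν) (s r : ℝ) {a : B}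
    (U : Set B) {f : ℕ → B} {m : ℕ} (hm : 1 ≤ m) (ha : (f 0, a) ∈ E)
    (hpos : 0 < μ (pastCyl f m ∩ {x | x (-(m : ℤ) - 1) ∈ U}))
    (h : 0 ≤ s * (μ.real (pastCyl f m ∩ {x | x (-(m : ℤ) - 1) ∈ U} ∩ {x | x 0 = a}) -
      r * μ.real (pastCyl f m ∩ {x | x (-(m : ℤ) - 1) ∈ U}))) :
    ∃ q, IsPast E q ∧ (∀ i < m, q i = f i) ∧ 0 ≤ s * (ν q a - r) := by
  have := hμ.1
  obtain ⟨u, hu⟩ := exists_extension_of_nonneg s r a U f m hpos h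
  obtain ⟨q, hqf, hq⟩ := exists_seq_of_step
    (P := fun k g => 0 < μ (pastCyl g k) ∧
      0 ≤ s * (μ.real (pastCyl g k ∩ {x | x 0 = a}) - r * μ.real (pastCyl g k)))
    (fun k g g' hg hP => by rwa [← pastCyl_congr hg])
    (fun k g hP => exists_extension_of_nonneg s r a Set.univ g k (by simpa using hP.1)
      (by simpa using hP.2)) hu
  have hqf' : ∀ i < m, q i = f i := fun i hi => by
    rw [hqf i (by omega), Function.update_of_ne (by omega)]
  have hqp : IsPast E q := hμ.isPast_of_pos fun k hk => (hq k hk).1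
  refine ⟨q, hqp, hqf', ?_⟩
  have hlim := ((hν q hqp a (by rwa [hqf' 0 (by omega)])).2.sub_const r).const_mul s
  refine ge_of_tendsto hlim ?_
  filter_upwards [eventually_ge_atTop (m + 1)] with k hk
  obtain ⟨h1, h2⟩ := hq k hk
  have hD : 0 < μ.real (pastCyl q k) := ENNReal.toReal_pos h1.ne' (measure_ne_top _ _)
  have : s * (μ.real (pastCyl q k ∩ {x | x 0 = a}) / μ.real (pastCyl q k) - r) =
      s * (μ.real (pastCyl q k ∩ {x | x 0 = a}) - r * μ.real (pastCyl q k)) /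
        μ.real (pastCyl q k) := by
    field_simp
  rw [this]
  positivity

/-- Conditioning on a cylinder that fixes the last `m` letters of a past `p`, and constrains one
more letter, approximates conditioning on `p` with relative error at most `γ m`. -/
theorem abs_ratio_div_sub_one_le {E : Set (B × B)} {μ : Measure (ℤ → B)} (hμ : GoodMeasure E μ)
    {ν : (ℕ → B) → B → ℝ} (hν : IsTransition E μ ν) {γ : ℕ → ℝ}
    (hγ : ∀ m : ℕ, 1 ≤ m → ∀ p q, IsPast E p → IsPast E q → (∀ i < m, p i = q i) →
        ∀ a, (p 0, a) ∈ E → |ν p a / ν q a - 1| ≤ γ m)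
    {a : B} (U : Set B) {p : ℕ → B} (hp : IsPast E p) {m : ℕ} (hm : 1 ≤ m) (ha : (p 0, a) ∈ E)
    (hpos : 0 < μ (pastCyl p m ∩ {x | x (-(m : ℤ) - 1) ∈ U})) :
    |μ.real (pastCyl p m ∩ {x | x (-(m : ℤ) - 1) ∈ U} ∩ {x | x 0 = a}) /
      μ.real (pastCyl p m ∩ {x | x (-(m : ℤ) - 1) ∈ U}) / ν p a - 1| ≤ γ m := by
  have := hμ.1
  set D := μ.real (pastCyl p m ∩ {x | x (-(m : ℤ) - 1) ∈ U}) with hDdef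
  set N := μ.real (pastCyl p m ∩ {x | x (-(m : ℤ) - 1) ∈ U} ∩ {x | x 0 = a})
  have hD : 0 < D := ENNReal.toReal_pos hpos.ne' (measure_ne_top _ _)
  have hND : N - N / D * D = 0 := by field_simp; ring
  have key : ∀ s : ℝ, ∃ q, IsPast E q ∧ (∀ i < m, q i = p i) ∧ 0 ≤ s * (ν q a - N / D) :=
    fun s => exists_past_of_nonneg hμ hν s (N / D) U hm ha hpos (by
      rw [← hDdef, hND, mul_zero])
  have hpa := (hν p hp a ha).1
  obtain ⟨q, hq, hqp, hq1⟩ := key 1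
  obtain ⟨q', hq', hqp', hq1'⟩ := key (-1)
  have b1 := abs_le.1 (hγ m hm q p hq hp hqp a (by rwa [hqp 0 (by omega)]))
  have b2 := abs_le.1 (hγ m hm q' p hq' hp hqp' a (by rwa [hqp' 0 (by omega)]))
  have c1 : N / D / ν p a ≤ ν q a / ν p a := by gcongr; linarith
  have c2 : ν q' a / ν p a ≤ N / D / ν p a := by gcongr; linarith
  rw [abs_le]
  constructor <;> linarith [b1.1, b1.2, b2.1, b2.2]

end Measure

theorem EveryLetterOccurs.exists_point {B : Type*} {E : Set (B × B)} (hE : EveryLetterOccurs E)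
    {g : ℕ → B} (hg : IsPast E g) {a : B} (ha : (g 0, a) ∈ E) :
    ∃ y ∈ TMC E, (∀ i : ℕ, y (-(i : ℤ) - 1) = g i) ∧ y 0 = a := by
  obtain ⟨z, hz, j, rfl⟩ := hE a
  refine ⟨fun k => if k < 0 then g (-k - 1).toNat else z (k + j), fun k => ?_, fun i => ?_, ?_⟩
  · rcases lt_trichotomy k (-1) with hk | rfl | hk
    · have h1 : k < 0 := by omega
      have h2 : k + 1 < 0 := by omega
      simp only [h1, h2, if_true]
      rw [show (-k - 1).toNat = (-(k + 1) - 1).toNat + 1 by omega]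
      exact hg _
    · simpa using ha
    · have h1 : ¬ k < 0 := by omega
      have h2 : ¬ k + 1 < 0 := by omega
      simp only [h1, h2, if_false]
      rw [add_right_comm]
      exact hz _
  · have h1 : -(i : ℤ) - 1 < 0 := by omega
    simp only [h1, if_true]
    congr 1
    omega
  · simp

theorem measurable_code {B B' : Type*} [Finite B] [MeasurableSpace B] [MeasurableSingletonClass B]
    [MeasurableSpace B'] (ψ : B → B') : Measurable (fun (x : ℤ → B) (i : ℤ) => ψ (x i)) :=
  measurable_pi_lambda _ fun i => (measurable_of_finite ψ).comp (measurable_pi_apply i)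

section Code

variable {B B' : Type*} {E : Set (B × B)} {E' : Set (B' × B')} {ψ : B → B'} {L : B' → B' → B}

theorem exists_lift (hE' : EveryLetterOccurs E')
    (hsurj : Set.SurjOn (fun x : ℤ → B => ψ ∘ x) (TMC E) (TMC E'))
    (hinv : ∀ x ∈ TMC E, ∀ j : ℤ, x j = L (ψ (x (j - 1))) (ψ (x j)))
    {g : ℕ → B'} (hg : IsPast E' g) {a : B'} (ha : (g 0, a) ∈ E') :
    ∃ x ∈ TMC E, (∀ i : ℕ, x (-(i : ℤ) - 1) = L (g (i + 1)) (g i)) ∧ x 0 = L (g 0) a ∧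
      (∀ i : ℕ, ψ (x (-(i : ℤ) - 1)) = g i) ∧ ψ (x 0) = a := by
  obtain ⟨y, hy, hyg, hya⟩ := hE'.exists_point hg ha
  obtain ⟨x, hx, rfl⟩ := hsurj hy
  simp only [Function.comp_apply] at hyg hya
  refine ⟨x, hx, fun i => ?_, ?_, hyg, hya⟩
  · rw [hinv x hx, hyg, ← hyg (i + 1)]
    congr 3
    push_cast
    ring_nf
  · rw [hinv x hx, hya, ← hyg 0]
    simp

theorem isPast_lift (hE' : EveryLetterOccurs E')
    (hsurj : Set.SurjOn (fun x : ℤ → B => ψ ∘ x) (TMC E) (TMC E'))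
    (hinv : ∀ x ∈ TMC E, ∀ j : ℤ, x j = L (ψ (x (j - 1))) (ψ (x j)))
    {g : ℕ → B'} (hg : IsPast E' g) {a : B'} (ha : (g 0, a) ∈ E') :
    IsPast E (fun i => L (g (i + 1)) (g i)) ∧ (L (g 1) (g 0), L (g 0) a) ∈ E := by
  obtain ⟨x, hx, hxg, hx0, -⟩ := exists_lift hE' hsurj hinv hg ha
  constructor
  · intro i
    have := hx (-((i + 1 : ℕ) : ℤ) - 1)
    rw [hxg, show -((i + 1 : ℕ) : ℤ) - 1 + 1 = -(i : ℤ) - 1 by push_cast; ring, hxg] at this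
    exact this
  · have := hx (-((0 : ℕ) : ℤ) - 1)
    rw [hxg, show -((0 : ℕ) : ℤ) - 1 + 1 = 0 by simp, hx0] at this
    exact this

theorem code_mem_pastCyl_iff
    (hinv : ∀ x ∈ TMC E, ∀ j : ℤ, x j = L (ψ (x (j - 1))) (ψ (x j)))
    {g : ℕ → B'} (hψ : ∀ i, ψ (L (g (i + 1)) (g i)) = g i) (m : ℕ) {x : ℤ → B}
    (hx : x ∈ TMC E) :
    (fun i => ψ (x i)) ∈ pastCyl g (m + 1) ↔
      x ∈ pastCyl (fun i => L (g (i + 1)) (g i)) m ∩ {x | x (-(m : ℤ) - 1) ∈ {u | ψ u = g m}} := by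
  simp only [pastCyl, Set.mem_inter_iff, Set.mem_ofPred_eq]
  constructor
  · intro h
    refine ⟨fun i hi => ?_, h m (by omega)⟩
    rw [hinv x hx, h i (by omega), ← h (i + 1) (by omega)]
    congr 3
    push_cast
    ring
  · rintro ⟨h, h'⟩ i hi
    rcases Nat.lt_succ_iff_lt_or_eq.mp hi with hi | rfl
    · rw [h i hi, hψ]
    · exact h'

theorem code_mem_pastCyl_inter_iff
    (hinv : ∀ x ∈ TMC E, ∀ j : ℤ, x j = L (ψ (x (j - 1))) (ψ (x j)))
    {g : ℕ → B'} (hψ : ∀ i, ψ (L (g (i + 1)) (g i)) = g i) {a : B'} (ha : ψ (L (g 0) a) = a)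
    (m : ℕ) {x : ℤ → B} (hx : x ∈ TMC E) :
    (fun i => ψ (x i)) ∈ pastCyl g (m + 1) ∩ {y | y 0 = a} ↔
      x ∈ pastCyl (fun i => L (g (i + 1)) (g i)) m ∩
        {x | x (-(m : ℤ) - 1) ∈ {u | ψ u = g m}} ∩ {x | x 0 = L (g 0) a} := by
  rw [Set.mem_inter_iff, Set.mem_inter_iff x _ {x | x 0 = L (g 0) a},
    ← code_mem_pastCyl_iff hinv hψ m hx]
  refine and_congr_right fun h => ?_
  have h0 := h 0 (by omega)
  simp only [Set.mem_ofPred_eq]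
  constructor
  · intro h1
    rw [hinv x hx, h1, ← h0]
    simp
  · intro h1
    rw [h1, ha]

variable [Finite B] [MeasurableSpace B] [MeasurableSingletonClass B] [MeasurableSpace B']

theorem GoodMeasure.map_code {μ : Measure (ℤ → B)} (hμ : GoodMeasure E μ)
    (hbij : Set.BijOn (fun x : ℤ → B => ψ ∘ x) (TMC E) (TMC E')) :
    GoodMeasure E' (Measure.map (fun x i => ψ (x i)) μ) := by
  have := hμ.1
  have hm := measurable_code ψ
  have hprob : IsProbabilityMeasure (Measure.map (fun x i => ψ (x i)) μ) :=
    Measure.isProbabilityMeasure_map hm.aemeasurable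
  refine ⟨hprob, ?_, le_antisymm prob_le_one ?_, fun m w hw => ?_⟩
  · rw [Measure.map_map measurable_shiftMap hm]
    conv_rhs => rw [← hμ.2.1]
    rw [Measure.map_map hm measurable_shiftMap]
    rfl
  · rw [← hμ.2.2.1]
    exact (measure_mono fun x hx => hbij.mapsTo hx).trans (Measure.le_map_apply hm.aemeasurable _)
  · obtain ⟨y, hy, j, hj⟩ := hw
    obtain ⟨x, hx, rfl⟩ := hbij.surjOn hy
    refine (hμ.2.2.2 m (fun i => x (j + ((i : ℕ) : ℤ))) ⟨x, hx, j, fun _ => rfl⟩).trans_le ?_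
    refine (measure_mono fun z hz => ?_).trans (Measure.le_map_apply hm.aemeasurable _)
    intro i
    rw [← hj i]
    exact congrArg ψ (hz i)

variable [Finite B'] [MeasurableSingletonClass B']

/-- A bijective 1-block code whose inverse has memory 1 and anticipation 0 preserves complete
connections and summable decay. -/
theorem CCSD.map_code {μ : Measure (ℤ → B)} (hμ : GoodMeasure E μ) (h : CCSD E μ)
    (hE' : EveryLetterOccurs E')
    (hbij : Set.BijOn (fun x : ℤ → B => ψ ∘ x) (TMC E) (TMC E'))
    (hinv : ∀ x ∈ TMC E, ∀ j : ℤ, x j = L (ψ (x (j - 1))) (ψ (x j))) :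
    CCSD E' (Measure.map (fun x i => ψ (x i)) μ) := by
  have := hμ.1
  have hm := measurable_code ψ
  have hμ' := hμ.map_code hbij
  obtain ⟨ν, hν, γ, hγs, hγ⟩ := h
  simp only [hμ.tendsto_iff] at hν
  change IsTransition E μ ν at hν
  obtain ⟨K, hK⟩ := hν.exists_div_le hμ (c := γ 1) fun p q hp hq hpq a ha =>
    hγ 1 le_rfl p q hp hq (fun i hi => by rwa [Nat.lt_one_iff.1 hi]) a ha
  refine ⟨fun g a => ν (fun i => L (g (i + 1)) (g i)) (L (g 0) a), fun g hg a ha => ?_,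
    fun m => if m ≤ 1 then K + 1 else γ (m - 1), ?_, fun m hm1 g g' hg hg' hgg a ha => ?_⟩
  · obtain ⟨hp, hpa⟩ := isPast_lift hE' hbij.surjOn hinv hg ha
    obtain ⟨x, hx, hxg, hx0, hψg, hψa⟩ := exists_lift hE' hbij.surjOn hinv hg ha
    have hψ : ∀ i, ψ (L (g (i + 1)) (g i)) = g i := fun i => by rw [← hxg, hψg]
    have hψa' : ψ (L (g 0) a) = a := by rw [← hx0, hψa]
    set p : ℕ → B := fun i => L (g (i + 1)) (g i) with hpdef
    refine ⟨(hν p hp _ hpa).1, ?_⟩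
    rw [hμ'.tendsto_iff, ← tendsto_add_atTop_iff_nat 1]
    have hD : ∀ m, (Measure.map (fun x i => ψ (x i)) μ) (pastCyl g (m + 1)) =
        μ (pastCyl p m ∩ {x | x (-(m : ℤ) - 1) ∈ {u | ψ u = g m}}) := fun m => by
      rw [Measure.map_apply hm (measurableSet_pastCyl _ _)]
      refine measure_congr ?_
      filter_upwards [hμ.ae_mem] with z hz
      exact propext (code_mem_pastCyl_iff hinv hψ m hz)
    have hN : ∀ m, (Measure.map (fun x i => ψ (x i)) μ) (pastCyl g (m + 1) ∩ {y | y 0 = a}) =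
        μ (pastCyl p m ∩ {x | x (-(m : ℤ) - 1) ∈ {u | ψ u = g m}} ∩
          {x | x 0 = L (g 0) a}) := fun m => by
      rw [Measure.map_apply hm ((measurableSet_pastCyl _ _).inter (measurableSet_coord_eq 0 a))]
      refine measure_congr ?_
      filter_upwards [hμ.ae_mem] with z hz
      exact propext (code_mem_pastCyl_inter_iff hinv hψ hψa' m hz)
    simp only [measureReal_def, hD, hN]
    simp only [← measureReal_def]
    have hνp := (hν p hp _ hpa).1
    have hbound : ∀ m, 1 ≤ m → _ := fun m hm1 =>
      abs_ratio_div_sub_one_le hμ hν hγ {u | ψ u = g m} hp hm1 hpa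
        (by
          rw [← hD]
          exact hμ'.pastCyl_pos (hbij.mapsTo hx) fun i _ => hψg i)
    have h1 : Tendsto (fun m : ℕ => μ.real (pastCyl p m ∩
        {x | x (-(m : ℤ) - 1) ∈ {u | ψ u = g m}} ∩ {x | x 0 = L (g 0) a}) /
        μ.real (pastCyl p m ∩ {x | x (-(m : ℤ) - 1) ∈ {u | ψ u = g m}}) / ν p (L (g 0) a))
        atTop (𝓝 1) := tendsto_iff_norm_sub_tendsto_zero.2 (squeeze_zero'
      (Eventually.of_forall fun m => norm_nonneg _)
      ((eventually_ge_atTop 1).mono fun m hm1 => hbound m hm1) hγs.tendsto_atTop_zero)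
    have h2 := h1.mul_const (ν p (L (g 0) a))
    rw [one_mul] at h2
    refine h2.congr fun m => ?_
    field_simp
  · rw [← summable_nat_add_iff 2]
    refine ((summable_nat_add_iff 1).2 hγs).congr fun m => ?_
    rw [if_neg (by omega)]
    rfl
  · have ha' : (g' 0, a) ∈ E' := by rwa [← hgg 0 (by omega)]
    obtain ⟨hp, hpa⟩ := isPast_lift hE' hbij.surjOn hinv hg ha
    obtain ⟨hp', hpa'⟩ := isPast_lift hE' hbij.surjOn hinv hg' ha'
    simp only
    split_ifs with hm2
    · have h1 := hK _ _ hp hp' _ _ hpa hpa'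
      have h2 := div_pos (hν _ hp _ hpa).1 (hν _ hp' _ hpa').1
      rw [abs_le]
      constructor <;> linarith
    · rw [← hgg 0 (by omega)]
      exact hγ (m - 1) (by omega) _ _ hp hp'
        (fun i hi => by rw [hgg i (by omega), hgg (i + 1) (by omega)]) _ hpa

end Code

theorem mem_TMC_prodE_univ_iff {K C : Type*} {E : Set (K × K)} {x : ℤ → K × C} :
    x ∈ TMC (prodE E Set.univ) ↔ (fun i => (x i).1) ∈ TMC E := by
  simp [TMC, prodE]

theorem EveryLetterOccurs.prodE_univ {K C : Type*} {E : Set (K × K)} (hE : EveryLetterOccurs E) :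
    EveryLetterOccurs (prodE E (Set.univ : Set (C × C))) := by
  rintro ⟨k, c⟩
  obtain ⟨x, hx, i, rfl⟩ := hE k
  exact ⟨fun j => (x j, c), mem_TMC_prodE_univ_iff.2 hx, i, rfl⟩

theorem bijOn_prodE_univ {K K' C : Type*} {E : Set (K × K)} {E' : Set (K' × K')} {θ : K → K'}
    (hbij : Set.BijOn (fun x : ℤ → K => θ ∘ x) (TMC E) (TMC E')) :
    Set.BijOn (fun x : ℤ → K × C => (fun b : K × C => (θ b.1, b.2)) ∘ x)
      (TMC (prodE E Set.univ)) (TMC (prodE E' Set.univ)) := by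
  refine ⟨fun x hx => ?_, fun x hx y hy hxy => ?_, fun y hy => ?_⟩
  · exact mem_TMC_prodE_univ_iff.2 (hbij.mapsTo (mem_TMC_prodE_univ_iff.1 hx))
  · have h1 := hbij.injOn (mem_TMC_prodE_univ_iff.1 hx) (mem_TMC_prodE_univ_iff.1 hy)
      (funext fun i => congrArg Prod.fst (congrFun hxy i))
    have h2 : ∀ i, (x i).2 = (y i).2 := fun i => (Prod.mk.inj (congrFun hxy i)).2
    exact funext fun i => Prod.ext (congrFun h1 i) (h2 i)
  · obtain ⟨x, hx, hxy⟩ := hbij.surjOn (mem_TMC_prodE_univ_iff.1 hy)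
    exact ⟨fun i => (x i, (y i).2), mem_TMC_prodE_univ_iff.2 hx,
      funext fun i => Prod.ext (congrFun hxy i) rfl⟩

end CAStmt

/-- Lemma: `Θ × id` on a product with a full shift preserves complete
connections and summable decay. -/
theorem CAStmt.stmt12 {A A' : Type} [Fintype A] [Fintype A']
    [MeasurableSpace A] [MeasurableSingletonClass A]
    [MeasurableSpace A'] [MeasurableSingletonClass A']
    (n : ℕ) (hn : 1 ≤ n)
    (E : Set (A × A)) (E' : Set (A' × A'))
    (hE : EveryLetterOccurs E) (hE' : EveryLetterOccurs E')
    (θ : A → A')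
    (hbij : Set.BijOn (fun x => θ ∘ x) (TMC E) (TMC E'))
    (hpred : ∀ c a b : A, (a, c) ∈ E → (b, c) ∈ E → θ a = θ b)
    (θ' : A' → A' → A)
    (hinv : ∀ x ∈ TMC E, ∀ j : ℤ, x j = θ' (θ (x (j - 1))) (θ (x j)))
    (μ : Measure (ℤ → A × Fin n))
    (hgood : GoodMeasure (prodE E (Set.univ : Set (Fin n × Fin n))) μ)
    (hccsd : CCSD (prodE E (Set.univ : Set (Fin n × Fin n))) μ) :
    GoodMeasure (prodE E' (Set.univ : Set (Fin n × Fin n)))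
      (Measure.map (fun x : ℤ → A × Fin n => fun i => (θ (x i).1, (x i).2)) μ) ∧
    CCSD (prodE E' (Set.univ : Set (Fin n × Fin n)))
      (Measure.map (fun x : ℤ → A × Fin n => fun i => (θ (x i).1, (x i).2)) μ) := by
  have hbij' := bijOn_prodE_univ (C := Fin n) hbij
  have hmap := hgood.map_code hbij'
  have hmap' := hccsd.map_code hgood hE'.prodE_univ hbij' (L := fun b c => (θ' b.1 c.1, c.2))
    fun x hx j => Prod.ext (hinv _ (mem_TMC_prodE_univ_iff.1 hx) j) rfl
  exact ⟨hmap, hmap'⟩
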